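/- arXiv:1605.06049 — 5 statements merged into one kernel-verified Lean document; each statement's English description precedes it below -/
import Mathlib

section
/- Let B ∈ ℝ^{d×d} be symmetric positive definite, and let s, y ∈ ℝ^d satisfy s ≠ 0 and yᵀs ≠ 0. Then the BFGS update B₊ = B − (B s sᵀ B)/(sᵀ B s) + (y yᵀ)/(yᵀ s) satisfies det(B₊) = det(B) · (yᵀs)/(sᵀBs). -/
open Matrix

/-- The matrix determinant lemma for a rank-two perturbation of the identity. -/
theorem Matrix.det_one_add_vecMulVec_add_vecMulVec {m R : Type*} [Fintype m] [DecidableEq m]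
    [CommRing R] (u v w z : m → R) :
    (1 + (vecMulVec u v + vecMulVec w z)).det =
      (1 + v ⬝ᵥ u) * (1 + z ⬝ᵥ w) - (v ⬝ᵥ w) * (z ⬝ᵥ u) := by
  have h : vecMulVec u v + vecMulVec w z = (of ![u, w])ᵀ * of ![v, z] := by
    ext i j
    simp [mul_apply, vecMulVec_apply, Fin.sum_univ_two]
  rw [h, det_one_add_mul_comm, det_fin_two]
  simp [vecMul, dotProduct]

/-- Powell's determinant identity: if `B` is symmetric positive definite,
`s ≠ 0` and `yᵀs ≠ 0`, then `det(B₊) = det(B) · (yᵀs)/(sᵀBs)` for the BFGS update `B₊`. -/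
theorem stmt_4 {d : ℕ} (B : Matrix (Fin d) (Fin d) ℝ) (hB : B.PosDef)
    (s y : Fin d → ℝ) (hs : s ≠ 0) (hys : y ⬝ᵥ s ≠ 0) :
    (B - (s ⬝ᵥ B *ᵥ s)⁻¹ • (B * vecMulVec s s * B) +
        (y ⬝ᵥ s)⁻¹ • vecMulVec y y).det =
      B.det * ((y ⬝ᵥ s) / (s ⬝ᵥ B *ᵥ s)) := by
  have ha : s ⬝ᵥ B *ᵥ s ≠ 0 := by simpa using (hB.dotProduct_mulVec_pos hs).ne'
  have hu : IsUnit B.det := hB.det_pos.ne'.isUnit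
  have factor : B - (s ⬝ᵥ B *ᵥ s)⁻¹ • (B * vecMulVec s s * B) + (y ⬝ᵥ s)⁻¹ • vecMulVec y y =
      B * (1 + (vecMulVec (-(s ⬝ᵥ B *ᵥ s)⁻¹ • s) (s ᵥ* B) +
        vecMulVec ((y ⬝ᵥ s)⁻¹ • B⁻¹ *ᵥ y) y)) := by
    rw [mul_add, mul_add, mul_one, mul_vecMulVec, mul_vecMulVec, mul_vecMulVec, vecMulVec_mul,
      mulVec_smul, mulVec_smul, mulVec_mulVec, mul_nonsing_inv _ hu, one_mulVec,
      smul_vecMulVec, smul_vecMulVec, neg_smul, sub_eq_add_neg, add_assoc]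
  have hsy : (s ᵥ* B) ⬝ᵥ (B⁻¹ *ᵥ y) = y ⬝ᵥ s := by
    rw [← dotProduct_mulVec, mulVec_mulVec, mul_nonsing_inv _ hu, one_mulVec, dotProduct_comm]
  rw [factor, det_mul, det_one_add_vecMulVec_add_vecMulVec]
  simp only [dotProduct_smul, smul_eq_mul, hsy, ← dotProduct_mulVec s B s]
  field_simp
  ring
end

section
/- (Lemma 3.1, strongly convex case.) Let d ≥ 1, m ≥ 1 be integers and 0 < λ̂ ≤ Λ̂ constants. There exist constants 0 < μ₁ ≤ μ₂, depending only on d, m, λ̂, Λ̂, with the following property: for every finite sequence of pairs (s₁, y₁), …, (s_m, y_m) in ℝ^d × ℝ^d satisfying for each j that y_jᵀs_j ≥ λ̂·‖s_j‖² > 0 and λ̂ ≤ ‖y_j‖²/(y_jᵀs_j) ≤ Λ̂, the matrices defined recursively by B^{(0)} = (‖y_m‖²/(y_mᵀs_m))·I and B^{(i+1)} = B^{(i)} − (B^{(i)} s_{i+1} s_{i+1}ᵀ B^{(i)})/(s_{i+1}ᵀ B^{(i)} s_{i+1}) + (y_{i+1} y_{i+1}ᵀ)/(y_{i+1}ᵀ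 s_{i+1}) for i = 0, …, m−1 are all well defined, symmetric positive definite, and the final matrix B = B^{(m)} satisfies μ₁·I ⪯ B ⪯ μ₂·I; consequently its inverse H = B^{−1} satisfies (1/μ₂)·I ⪯ H ⪯ (1/μ₁)·I. -/
open Matrix

/-- The (direct) BFGS update `B₊ = B − (B s sᵀ B)/(sᵀ B s) + (y yᵀ)/(yᵀ s)`. -/
noncomputable def bfgsUpdate {d : ℕ} (B : Matrix (Fin d) (Fin d) ℝ) (s y : Fin d → ℝ) :
    Matrix (Fin d) (Fin d) ℝ :=
  B - (s ⬝ᵥ B *ᵥ s)⁻¹ • (B * vecMulVec s s * B) + (y ⬝ᵥ s)⁻¹ • vecMulVec y y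

/-- The inner L-BFGS loop: `B⁽⁰⁾ = (‖y_m‖²/(y_mᵀ s_m))·I` and
`B⁽ⁱ⁺¹⁾ = bfgsUpdate B⁽ⁱ⁾ s_{i+1} y_{i+1}`, with pairs indexed `1, …, m`. -/
noncomputable def bfgsSeq {d : ℕ} (m : ℕ) (s y : ℕ → Fin d → ℝ) :
    ℕ → Matrix (Fin d) (Fin d) ℝ
  | 0 => ((y m ⬝ᵥ y m) / (y m ⬝ᵥ s m)) • 1
  | i + 1 => bfgsUpdate (bfgsSeq m s y i) (s (i + 1)) (y (i + 1))

/-- `B` is symmetric and `a·I ⪯ B ⪯ b·I`, in terms of the quadratic form of `B`. -/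
def QuadBounded {d : ℕ} (a b : ℝ) (B : Matrix (Fin d) (Fin d) ℝ) : Prop :=
  B.IsHermitian ∧ ∀ x : Fin d → ℝ, a * (x ⬝ᵥ x) ≤ x ⬝ᵥ B *ᵥ x ∧ x ⬝ᵥ B *ᵥ x ≤ b * (x ⬝ᵥ x)

theorem Matrix.IsHermitian.dotProduct_mulVec_swap {d : ℕ} {B : Matrix (Fin d) (Fin d) ℝ}
    (hB : B.IsHermitian) (x z : Fin d → ℝ) : x ⬝ᵥ B *ᵥ z = z ⬝ᵥ B *ᵥ x := by
  have hT : Bᵀ = B := by simpa [IsHermitian, conjTranspose_eq_transpose_of_trivial] using hB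
  rw [dotProduct_mulVec, ← mulVec_transpose, hT, dotProduct_comm]

theorem isHermitian_smul_one {d : ℕ} (c : ℝ) :
    (c • (1 : Matrix (Fin d) (Fin d) ℝ)).IsHermitian := by
  simp [IsHermitian]

theorem dotProduct_self_nonneg_real {d : ℕ} (x : Fin d → ℝ) : 0 ≤ x ⬝ᵥ x :=
  Finset.sum_nonneg fun i _ => mul_self_nonneg (x i)

theorem dotProduct_self_pos_real {d : ℕ} {x : Fin d → ℝ} (hx : x ≠ 0) : 0 < x ⬝ᵥ x :=
  (dotProduct_self_nonneg_real x).lt_of_ne' fun h => hx (dotProduct_self_eq_zero.1 h)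

theorem sq_dotProduct_le {d : ℕ} (x z : Fin d → ℝ) :
    (x ⬝ᵥ z) ^ 2 ≤ (x ⬝ᵥ x) * (z ⬝ᵥ z) := by
  simpa [dotProduct, sq] using Finset.sum_mul_sq_le_sq_mul_sq Finset.univ x z

theorem QuadBounded.posDef {d : ℕ} {a b : ℝ} {B : Matrix (Fin d) (Fin d) ℝ}
    (h : QuadBounded a b B) (ha : 0 < a) : B.PosDef :=
  PosDef.of_dotProduct_mulVec_pos h.1 fun x hx => by
    simpa using (mul_pos ha (dotProduct_self_pos_real hx)).trans_le (h.2 x).1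

theorem QuadBounded.posSemidef_sub_smul_one {d : ℕ} {a b : ℝ} {B : Matrix (Fin d) (Fin d) ℝ}
    (h : QuadBounded a b B) : (B - a • 1).PosSemidef :=
  PosSemidef.of_dotProduct_mulVec_nonneg (h.1.sub (isHermitian_smul_one a)) fun x => by
    simpa [sub_mulVec, smul_mulVec] using (h.2 x).1

theorem QuadBounded.posSemidef_smul_one_sub {d : ℕ} {a b : ℝ} {B : Matrix (Fin d) (Fin d) ℝ}
    (h : QuadBounded a b B) : (b • 1 - B).PosSemidef :=
  PosSemidef.of_dotProduct_mulVec_nonneg ((isHermitian_smul_one b).sub h.1) fun x => by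
    simpa [sub_mulVec, smul_mulVec] using (h.2 x).2

theorem QuadBounded.inv {d : ℕ} {a b : ℝ} {B : Matrix (Fin d) (Fin d) ℝ}
    (h : QuadBounded a b B) (ha : 0 < a) (hab : a ≤ b) : QuadBounded b⁻¹ a⁻¹ B⁻¹ := by
  have hb : 0 < b := ha.trans_le hab
  refine ⟨h.1.inv, fun z => ?_⟩
  have hu : IsUnit B.det := (isUnit_iff_isUnit_det B).1 (h.posDef ha).isUnit
  obtain ⟨x, hx⟩ : ∃ x, x = B⁻¹ *ᵥ z := ⟨_, rfl⟩
  have hz : B *ᵥ x = z := by rw [hx, mulVec_mulVec, mul_nonsing_inv _ hu, one_mulVec]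
  rw [← hx]
  have hswap := h.1.dotProduct_mulVec_swap x z
  have hzx : x ⬝ᵥ B *ᵥ x = z ⬝ᵥ x := by rw [hz, dotProduct_comm]
  rw [hz] at hswap
  constructor
  · have hq := (mul_nonneg ha.le (dotProduct_self_nonneg_real _)).trans (h.2 (b • x - z)).1
    have hzB := (h.2 z).2
    have hexp : (b • x - z) ⬝ᵥ B *ᵥ (b • x - z)
        = b ^ 2 * (z ⬝ᵥ x) - 2 * b * (z ⬝ᵥ z) + z ⬝ᵥ B *ᵥ z := by
      simp only [mulVec_sub, mulVec_smul, sub_dotProduct, dotProduct_sub, smul_dotProduct,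
        dotProduct_smul, smul_eq_mul, hz, ← hswap, dotProduct_comm x z]
      rw [show x ⬝ᵥ B *ᵥ z = z ⬝ᵥ z by rw [h.1.dotProduct_mulVec_swap, hz]]
      ring
    rw [inv_mul_le_iff₀ hb]
    refine le_of_mul_le_mul_left ?_ hb
    linarith
  · have hn := dotProduct_self_nonneg_real (z - a • x)
    have hxB := (h.2 x).1
    have hexp : (z - a • x) ⬝ᵥ (z - a • x)
        = z ⬝ᵥ z - 2 * a * (z ⬝ᵥ x) + a * (a * (x ⬝ᵥ x)) := by
      simp only [sub_dotProduct, dotProduct_sub, smul_dotProduct, dotProduct_smul, smul_eq_mul,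
        dotProduct_comm x z]
      ring
    rw [le_inv_mul_iff₀ ha]
    have := mul_le_mul_of_nonneg_left hxB ha.le
    rw [hzx] at this
    linarith

theorem dotProduct_bfgsUpdate_mulVec {d : ℕ} {B : Matrix (Fin d) (Fin d) ℝ}
    (hB : B.IsHermitian) (s y x : Fin d → ℝ) :
    x ⬝ᵥ bfgsUpdate B s y *ᵥ x
      = x ⬝ᵥ B *ᵥ x - (s ⬝ᵥ B *ᵥ s)⁻¹ * (s ⬝ᵥ B *ᵥ x) ^ 2 + (y ⬝ᵥ s)⁻¹ * (y ⬝ᵥ x) ^ 2 := by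
  have h1 : x ⬝ᵥ (B * vecMulVec s s * B) *ᵥ x = (s ⬝ᵥ B *ᵥ x) ^ 2 := by
    rw [← mulVec_mulVec, ← mulVec_mulVec, vecMulVec_mulVec, op_smul_eq_smul, mulVec_smul,
      dotProduct_smul, hB.dotProduct_mulVec_swap x s, smul_eq_mul, sq]
  have h2 : x ⬝ᵥ vecMulVec y y *ᵥ x = (y ⬝ᵥ x) ^ 2 := by
    rw [vecMulVec_mulVec, op_smul_eq_smul, dotProduct_smul, dotProduct_comm x y, smul_eq_mul, sq]
  rw [bfgsUpdate, add_mulVec, sub_mulVec, smul_mulVec, smul_mulVec, dotProduct_add,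
    dotProduct_sub, dotProduct_smul, dotProduct_smul, h1, h2, smul_eq_mul, smul_eq_mul]

theorem isHermitian_bfgsUpdate {d : ℕ} {B : Matrix (Fin d) (Fin d) ℝ}
    (hB : B.IsHermitian) (s y : Fin d → ℝ) : (bfgsUpdate B s y).IsHermitian := by
  have hT : Bᵀ = B := by simpa [IsHermitian, conjTranspose_eq_transpose_of_trivial] using hB
  simp [IsHermitian, conjTranspose_eq_transpose_of_trivial, bfgsUpdate, transpose_mul, hT,
    Matrix.mul_assoc, transpose_vecMulVec]

/-- The BFGS update preserves two-sided bounds, with constants that do not depend on the pair. -/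
theorem QuadBounded.bfgsUpdate {d : ℕ} {a b lam Lam : ℝ} {B : Matrix (Fin d) (Fin d) ℝ}
    (h : QuadBounded a b B) (ha : 0 < a) (hlam : 0 < lam) (hLam : 0 < Lam) {s y : Fin d → ℝ}
    (hs : 0 < s ⬝ᵥ s) (hys : lam * (s ⬝ᵥ s) ≤ y ⬝ᵥ s) (hyy : y ⬝ᵥ y ≤ Lam * (y ⬝ᵥ s)) :
    QuadBounded (3 * (1 + Lam / lam) / a + 3 / lam)⁻¹ (b + Lam) (bfgsUpdate B s y) := by
  refine ⟨isHermitian_bfgsUpdate h.1 s y, fun x => ?_⟩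
  rw [dotProduct_bfgsUpdate_mulVec h.1]
  have hr : 0 < y ⬝ᵥ s := (mul_pos hlam hs).trans_le hys
  have hq : 0 < s ⬝ᵥ B *ᵥ s := (mul_pos ha hs).trans_le (h.2 s).1
  constructor
  · obtain ⟨t, ht⟩ : ∃ t, t = (s ⬝ᵥ B *ᵥ s)⁻¹ * (s ⬝ᵥ B *ᵥ x) := ⟨_, rfl⟩
    obtain ⟨u, hu⟩ : ∃ u, u = x - t • s := ⟨_, rfl⟩
    have hproj : x ⬝ᵥ B *ᵥ x - (s ⬝ᵥ B *ᵥ s)⁻¹ * (s ⬝ᵥ B *ᵥ x) ^ 2 = u ⬝ᵥ B *ᵥ u := by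
      simp only [hu, mulVec_sub, mulVec_smul, sub_dotProduct, dotProduct_sub, smul_dotProduct,
        dotProduct_smul, smul_eq_mul, h.1.dotProduct_mulVec_swap x s, ht]
      field_simp
      ring
    have hub := (h.2 u).1
    have hxu : x = u + t • s := by simp [hu]
    have hyx : y ⬝ᵥ x = y ⬝ᵥ u + t * (y ⬝ᵥ s) := by
      simp [hxu]
    obtain ⟨p, hp⟩ : ∃ p, p = (y ⬝ᵥ s)⁻¹ * (y ⬝ᵥ x) := ⟨_, rfl⟩
    obtain ⟨q, hq'⟩ : ∃ q, q = (y ⬝ᵥ s)⁻¹ * (y ⬝ᵥ u) := ⟨_, rfl⟩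
    have htpq : t = p - q := by rw [hp, hq', hyx]; field_simp; ring
    have hx3 : x ⬝ᵥ x ≤ 3 * (u ⬝ᵥ u + q ^ 2 * (s ⬝ᵥ s) + p ^ 2 * (s ⬝ᵥ s)) := by
      have h1 := dotProduct_self_nonneg_real (u + q • s)
      have h2 := dotProduct_self_nonneg_real (u - p • s)
      have h3 : 0 ≤ (p + q) ^ 2 * (s ⬝ᵥ s) := by positivity
      simp only [hxu, htpq, add_dotProduct, dotProduct_add, sub_dotProduct, dotProduct_sub,
        smul_dotProduct, dotProduct_smul, smul_eq_mul, dotProduct_comm s u] at h1 h2 ⊢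
      linarith
    have hsr : s ⬝ᵥ s ≤ (y ⬝ᵥ s) / lam := by rw [le_div_iff₀ hlam]; linarith
    have hpb : p ^ 2 * (s ⬝ᵥ s) ≤ (1 / lam) * ((y ⬝ᵥ s)⁻¹ * (y ⬝ᵥ x) ^ 2) := by
      calc p ^ 2 * (s ⬝ᵥ s) ≤ p ^ 2 * ((y ⬝ᵥ s) / lam) := by gcongr
        _ = _ := by rw [hp]; field_simp
    have hqb : q ^ 2 * (s ⬝ᵥ s) ≤ Lam / lam * (u ⬝ᵥ u) := by
      have huu := dotProduct_self_nonneg_real u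
      calc q ^ 2 * (s ⬝ᵥ s) ≤ q ^ 2 * ((y ⬝ᵥ s) / lam) := by gcongr
        _ = (y ⬝ᵥ u) ^ 2 / ((y ⬝ᵥ s) * lam) := by rw [hq']; field_simp
        _ ≤ (Lam * (y ⬝ᵥ s) * (u ⬝ᵥ u)) / ((y ⬝ᵥ s) * lam) := by
          gcongr
          exact (sq_dotProduct_le y u).trans (by gcongr)
        _ = _ := by field_simp
    rw [hproj, inv_mul_le_iff₀ (by positivity)]
    have hA : 0 ≤ (y ⬝ᵥ s)⁻¹ * (y ⬝ᵥ x) ^ 2 := by positivity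
    have hU : 0 ≤ u ⬝ᵥ B *ᵥ u := (mul_nonneg ha.le (dotProduct_self_nonneg_real u)).trans hub
    have hub' : u ⬝ᵥ u ≤ (u ⬝ᵥ B *ᵥ u) / a := by rw [le_div_iff₀ ha]; linarith
    calc x ⬝ᵥ x ≤ 3 * (1 + Lam / lam) * (u ⬝ᵥ u)
          + 3 / lam * ((y ⬝ᵥ s)⁻¹ * (y ⬝ᵥ x) ^ 2) := by
          rw [show 3 / lam = 3 * (1 / lam) by ring]
          linarith
      _ ≤ 3 * (1 + Lam / lam) * ((u ⬝ᵥ B *ᵥ u) / a)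
          + 3 / lam * ((y ⬝ᵥ s)⁻¹ * (y ⬝ᵥ x) ^ 2) := by gcongr
      _ = 3 * (1 + Lam / lam) / a * (u ⬝ᵥ B *ᵥ u)
          + 3 / lam * ((y ⬝ᵥ s)⁻¹ * (y ⬝ᵥ x) ^ 2) := by ring
      _ ≤ 3 * (1 + Lam / lam) / a * (u ⬝ᵥ B *ᵥ u + (y ⬝ᵥ s)⁻¹ * (y ⬝ᵥ x) ^ 2)
          + 3 / lam * (u ⬝ᵥ B *ᵥ u + (y ⬝ᵥ s)⁻¹ * (y ⬝ᵥ x) ^ 2) := by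
          gcongr <;> linarith
      _ = _ := by ring
  · have hxx := dotProduct_self_nonneg_real x
    have h1 : 0 ≤ (s ⬝ᵥ B *ᵥ s)⁻¹ * (s ⬝ᵥ B *ᵥ x) ^ 2 := by positivity
    have h2 : (y ⬝ᵥ s)⁻¹ * (y ⬝ᵥ x) ^ 2 ≤ Lam * (x ⬝ᵥ x) := by
      rw [inv_mul_le_iff₀ hr]
      calc (y ⬝ᵥ x) ^ 2 ≤ (y ⬝ᵥ y) * (x ⬝ᵥ x) := sq_dotProduct_le y x
        _ ≤ (Lam * (y ⬝ᵥ s)) * (x ⬝ᵥ x) := by gcongr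
        _ = _ := by ring
    linarith [(h.2 x).2]

theorem QuadBounded.mono {d : ℕ} {a a' b : ℝ} {B : Matrix (Fin d) (Fin d) ℝ}
    (h : QuadBounded a b B) (ha : a' ≤ a) : QuadBounded a' b B :=
  ⟨h.1, fun x => ⟨(mul_le_mul_of_nonneg_right ha (dotProduct_self_nonneg_real x)).trans
    (h.2 x).1, (h.2 x).2⟩⟩

theorem exists_quadBounded_bfgsSeq (d m : ℕ) (hm : 1 ≤ m) (lam Lam : ℝ) (hlam : 0 < lam)
    (hlamLam : lam ≤ Lam) (i : ℕ) (hi : i ≤ m) :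
    ∃ a b : ℝ, 0 < a ∧ a ≤ b ∧ ∀ s y : ℕ → Fin d → ℝ,
      (∀ j, 1 ≤ j → j ≤ m →
        (lam * (s j ⬝ᵥ s j) ≤ y j ⬝ᵥ s j ∧ 0 < lam * (s j ⬝ᵥ s j)) ∧
          lam ≤ (y j ⬝ᵥ y j) / (y j ⬝ᵥ s j) ∧ (y j ⬝ᵥ y j) / (y j ⬝ᵥ s j) ≤ Lam) →
      QuadBounded a b (bfgsSeq m s y i) := by
  have hLam : 0 < Lam := hlam.trans_le hlamLam
  induction i with
  | zero =>
    refine ⟨lam, Lam, hlam, hlamLam, fun s y h => ⟨isHermitian_smul_one _, fun x => ?_⟩⟩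
    obtain ⟨-, h1, h2⟩ := h m hm le_rfl
    have hxx := dotProduct_self_nonneg_real x
    rw [bfgsSeq, smul_mulVec, one_mulVec, dotProduct_smul, smul_eq_mul]
    exact ⟨by gcongr, by gcongr⟩
  | succ i ih =>
    obtain ⟨a, b, ha, hab, hB⟩ := ih (Nat.le_of_succ_le hi)
    have hb : 0 < b := ha.trans_le hab
    refine ⟨min (3 * (1 + Lam / lam) / a + 3 / lam)⁻¹ (b + Lam), b + Lam,
      lt_min (by positivity) (by positivity), min_le_right _ _, fun s y h => ?_⟩
    obtain ⟨⟨h1, h2⟩, -, h3⟩ := h (i + 1) (Nat.le_add_left 1 i) hi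
    exact ((hB s y h).bfgsUpdate ha hlam hLam (pos_of_mul_pos_right h2 hlam.le) h1
      ((div_le_iff₀ (h2.trans_le h1)).1 h3)).mono (min_le_left _ _)

/-- Lemma 3.1, strongly convex case: there are constants `0 < μ₁ ≤ μ₂`
depending only on `d, m, λ̂, Λ̂` such that for any curvature pairs `(s_j, y_j)`,
`j = 1, …, m`, with `y_jᵀs_j ≥ λ̂‖s_j‖² > 0` and `λ̂ ≤ ‖y_j‖²/(y_jᵀs_j) ≤ Λ̂`, all the
matrices of the inner L-BFGS loop are symmetric positive definite, and the final matrix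
`B = B⁽ᵐ⁾` satisfies `μ₁·I ⪯ B ⪯ μ₂·I`; consequently `H = B⁻¹` satisfies
`(1/μ₂)·I ⪯ H ⪯ (1/μ₁)·I`. -/
theorem stmt_6 (d m : ℕ) (hd : 1 ≤ d) (hm : 1 ≤ m)
    (lam Lam : ℝ) (hlam : 0 < lam) (hlamLam : lam ≤ Lam) :
    ∃ μ₁ μ₂ : ℝ, 0 < μ₁ ∧ μ₁ ≤ μ₂ ∧
      ∀ s y : ℕ → Fin d → ℝ,
        (∀ j, 1 ≤ j → j ≤ m →
          (lam * (s j ⬝ᵥ s j) ≤ y j ⬝ᵥ s j ∧ 0 < lam * (s j ⬝ᵥ s j)) ∧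
            lam ≤ (y j ⬝ᵥ y j) / (y j ⬝ᵥ s j) ∧ (y j ⬝ᵥ y j) / (y j ⬝ᵥ s j) ≤ Lam) →
        (∀ i, i ≤ m → (bfgsSeq m s y i).PosDef) ∧
          (bfgsSeq m s y m - μ₁ • 1).PosSemidef ∧
          ((μ₂ • 1 : Matrix (Fin d) (Fin d) ℝ) - bfgsSeq m s y m).PosSemidef ∧
          ((bfgsSeq m s y m)⁻¹ - μ₂⁻¹ • 1).PosSemidef ∧
          ((μ₁⁻¹ • 1 : Matrix (Fin d) (Fin d) ℝ) - (bfgsSeq m s y m)⁻¹).PosSemidef := by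
  obtain ⟨a, b, ha, hab, hB⟩ := exists_quadBounded_bfgsSeq d m hm lam Lam hlam hlamLam m le_rfl
  refine ⟨a, b, ha, hab, fun s y h => ⟨fun i hi => ?_, (hB s y h).posSemidef_sub_smul_one,
    (hB s y h).posSemidef_smul_one_sub, ((hB s y h).inv ha hab).posSemidef_sub_smul_one,
    ((hB s y h).inv ha hab).posSemidef_smul_one_sub⟩⟩
  obtain ⟨a', _, ha', -, hB'⟩ := exists_quadBounded_bfgsSeq d m hm lam Lam hlam hlamLam i hi
  exact (hB' s y h).posDef ha'
end

section
/- Let F : ℝ^d → ℝ be differentiable with ∇F Λ-Lipschitz continuous (Λ > 0). Fix w ∈ ℝ^d, a symmetric matrix H ∈ ℝ^{d×d} with μ₁·I ⪯ H ⪯ μ₂·I for constants 0 < μ₁ ≤ μ₂, a step length α > 0, and constants γ ≥ 0. Let g be an ℝ^d-valued random vector (on a probability space) with E[g] = ∇F(w) and E[‖g‖²] ≤ γ². Then E[F(w − α H g)] ≤ F(w) − α μ₁ ‖∇F(w)‖² + (α² μ₂² γ² Λ)/2. -/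
open Matrix MeasureTheory
open scoped RealInnerProductSpace

/-- The descent lemma, two-sided: a function with `Λ`-Lipschitz gradient differs from its
first-order expansion by at most `Λ / 2 * ‖v‖ ^ 2`. -/
theorem abs_sub_sub_inner_gradient_le {E : Type*} [NormedAddCommGroup E]
    [InnerProductSpace ℝ E] [CompleteSpace E] {F : E → ℝ} {Λ : ℝ} (hdiff : Differentiable ℝ F)
    (hlip : ∀ u v : E, ‖gradient F u - gradient F v‖ ≤ Λ * ‖u - v‖) (w v : E) :
    |F (w + v) - F w - ⟪gradient F w, v⟫| ≤ Λ / 2 * ‖v‖ ^ 2 := by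
  have hφ : ∀ t : ℝ, HasDerivAt (fun t : ℝ => F (w + t • v) - F w - t * ⟪gradient F w, v⟫)
      (⟪gradient F (w + t • v) - gradient F w, v⟫) t := by
    intro t
    have hline : HasDerivAt (fun t : ℝ => w + t • v) v t := by
      simpa using ((hasDerivAt_id t).smul_const v).const_add w
    have hF := (hdiff (w + t • v)).hasGradientAt.hasFDerivAt.comp_hasDerivAt t hline
    refine ((hF.sub_const (F w)).sub ((hasDerivAt_id t).mul_const ⟪gradient F w, v⟫)).congr_deriv ?_
    rw [InnerProductSpace.toDual_apply_apply, one_mul, inner_sub_left]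
  have hB : ∀ t : ℝ, HasDerivAt (fun t : ℝ => Λ / 2 * ‖v‖ ^ 2 * t ^ 2) (Λ * ‖v‖ ^ 2 * t) t := by
    intro t
    refine ((hasDerivAt_pow 2 t).const_mul (Λ / 2 * ‖v‖ ^ 2)).congr_deriv ?_
    push_cast
    ring
  have key := image_norm_le_of_norm_deriv_right_le_deriv_boundary (a := 0) (b := 1)
    (fun t _ => (hφ t).continuousAt.continuousWithinAt) (fun t _ => (hφ t).hasDerivWithinAt)
    (by simp) hB (fun t ht => ?_) (Set.right_mem_Icc.2 zero_le_one)
  · simpa using key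
  · calc ‖⟪gradient F (w + t • v) - gradient F w, v⟫‖
        ≤ ‖gradient F (w + t • v) - gradient F w‖ * ‖v‖ := norm_inner_le_norm _ _
      _ ≤ Λ * ‖w + t • v - w‖ * ‖v‖ := by gcongr; exact hlip _ _
      _ = Λ * ‖v‖ ^ 2 * t := by
        rw [add_sub_cancel_left, norm_smul, Real.norm_of_nonneg ht.1]
        ring

/-- A symmetric operator with `0 ≤ T ≤ c` in the Loewner order has norm at most `c`. -/
theorem LinearMap.IsSymmetric.norm_apply_sq_le {E : Type*} [NormedAddCommGroup E]
    [InnerProductSpace ℝ E] {T : E →ₗ[ℝ] E} (hT : T.IsSymmetric) {c : ℝ} (hc : 0 < c)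
    (hnonneg : ∀ x, 0 ≤ ⟪T x, x⟫) (hle : ∀ x, ⟪T x, x⟫ ≤ c * ‖x‖ ^ 2) (x : E) :
    ‖T x‖ ^ 2 ≤ c ^ 2 * ‖x‖ ^ 2 := by
  have h1 := hle (T x)
  have h2 := hnonneg (c • x - T x)
  have hsymm : ⟪T (T x), x⟫ = ‖T x‖ ^ 2 := by rw [hT, real_inner_self_eq_norm_sq]
  simp only [map_sub, map_smul, inner_sub_left, inner_sub_right, real_inner_smul_left,
    real_inner_smul_right, real_inner_self_eq_norm_sq, hsymm] at h2
  have h3 : ‖T x‖ ^ 2 ≤ c * ⟪T x, x⟫ := by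
    refine le_of_mul_le_mul_left ?_ hc
    nlinarith
  nlinarith [mul_le_mul_of_nonneg_left (hle x) hc.le]

/-- The quadratic form of a positive semidefinite difference of matrices. -/
theorem Matrix.PosSemidef.inner_toEuclideanLin_le {n : Type*} [Fintype n] [DecidableEq n]
    {A B : Matrix n n ℝ} (h : (B - A).PosSemidef) (x : EuclideanSpace ℝ n) :
    ⟪Matrix.toEuclideanLin A x, x⟫ ≤ ⟪Matrix.toEuclideanLin B x, x⟫ := by
  have := (Matrix.isPositive_toEuclideanLin_iff.2 h).re_inner_nonneg_left x
  simpa [inner_sub_left] using this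

/-- one-step expected descent for a stochastic quasi-Newton step:
if `∇F` is `Λ`-Lipschitz, `μ₁·I ⪯ H ⪯ μ₂·I` is symmetric, and `g` is a random vector
with `E[g] = ∇F(w)` and `E[‖g‖²] ≤ γ²`, then
`E[F(w − αHg)] ≤ F(w) − αμ₁‖∇F(w)‖² + α²μ₂²γ²Λ/2`. -/
theorem stmt_10 {d : ℕ} {Ω : Type*} [MeasurableSpace Ω] (μ : Measure Ω)
    [IsProbabilityMeasure μ]
    (F : EuclideanSpace ℝ (Fin d) → ℝ) (Λ : ℝ) (hΛ : 0 < Λ)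
    (hdiff : Differentiable ℝ F)
    (hlip : ∀ u v : EuclideanSpace ℝ (Fin d),
      ‖gradient F u - gradient F v‖ ≤ Λ * ‖u - v‖)
    (w : EuclideanSpace ℝ (Fin d))
    (H : Matrix (Fin d) (Fin d) ℝ) (hHsymm : H.IsSymm)
    (μ₁ μ₂ : ℝ) (hμ₁ : 0 < μ₁) (hμ₁₂ : μ₁ ≤ μ₂)
    (hH1 : (H - μ₁ • 1).PosSemidef)
    (hH2 : ((μ₂ • 1 : Matrix (Fin d) (Fin d) ℝ) - H).PosSemidef)
    (α : ℝ) (hα : 0 < α) (γ : ℝ) (hγ : 0 ≤ γ)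
    (g : Ω → EuclideanSpace ℝ (Fin d))
    (hgint : Integrable g μ)
    (hgmean : ∫ ω, g ω ∂μ = gradient F w)
    (hg2int : Integrable (fun ω => ‖g ω‖ ^ 2) μ)
    (hg2 : ∫ ω, ‖g ω‖ ^ 2 ∂μ ≤ γ ^ 2) :
    ∫ ω, F (w - α • Matrix.toEuclideanLin H (g ω)) ∂μ ≤
      F w - α * μ₁ * ‖gradient F w‖ ^ 2 + α ^ 2 * μ₂ ^ 2 * γ ^ 2 * Λ / 2 := by
  set T := Matrix.toEuclideanLin H with hTdef
  have hone : ∀ (c : ℝ) (x : EuclideanSpace ℝ (Fin d)),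
      ⟪Matrix.toEuclideanLin (c • (1 : Matrix (Fin d) (Fin d) ℝ)) x, x⟫ = c * ‖x‖ ^ 2 := by
    intro c x
    rw [map_smul, Matrix.toLpLin_one, LinearMap.smul_apply, LinearMap.id_apply,
      real_inner_smul_left, real_inner_self_eq_norm_sq]
  have hlower : ∀ x, μ₁ * ‖x‖ ^ 2 ≤ ⟪T x, x⟫ := fun x =>
    (hone μ₁ x).symm.trans_le (hH1.inner_toEuclideanLin_le x)
  have hupper : ∀ x, ⟪T x, x⟫ ≤ μ₂ * ‖x‖ ^ 2 := fun x =>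
    (hH2.inner_toEuclideanLin_le x).trans_eq (hone μ₂ x)
  have hTsymm : T.IsSymmetric := by
    rw [hTdef, Matrix.isSymmetric_toEuclideanLin_iff, Matrix.IsHermitian,
      Matrix.conjTranspose_eq_transpose_of_trivial]
    exact hHsymm
  have hnorm := hTsymm.norm_apply_sq_le (hμ₁.trans_le hμ₁₂)
    (fun x => (by positivity : 0 ≤ μ₁ * ‖x‖ ^ 2).trans (hlower x)) hupper
  have hexp : ∀ ω, |F (w - α • T (g ω)) - (F w - α * ⟪T (gradient F w), g ω⟫)| ≤
      Λ / 2 * (α ^ 2 * μ₂ ^ 2) * ‖g ω‖ ^ 2 := by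
    intro ω
    have h := abs_sub_sub_inner_gradient_le hdiff hlip w (-(α • T (g ω)))
    rw [← sub_eq_add_neg, inner_neg_right, real_inner_smul_right, ← hTsymm, norm_neg, norm_smul,
      mul_pow, Real.norm_eq_abs, sq_abs] at h
    calc _ = |F (w - α • T (g ω)) - F w - -(α * ⟪T (gradient F w), g ω⟫)| := by
          congr 1; ring
      _ ≤ Λ / 2 * (α ^ 2 * ‖T (g ω)‖ ^ 2) := h
      _ ≤ Λ / 2 * (α ^ 2 * (μ₂ ^ 2 * ‖g ω‖ ^ 2)) := by gcongr; exact hnorm _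
      _ = _ := by ring
  have hlin : Integrable (fun ω => F w - α * ⟪T (gradient F w), g ω⟫) μ :=
    (integrable_const _).sub ((hgint.const_inner _).const_mul _)
  have hquad : Integrable (fun ω => Λ / 2 * (α ^ 2 * μ₂ ^ 2) * ‖g ω‖ ^ 2) μ := hg2int.const_mul _
  have hmeas : AEStronglyMeasurable (fun ω => F (w - α • T (g ω))) μ :=
    (hdiff.continuous.comp (continuous_const.sub
      (T.continuous_of_finiteDimensional.const_smul α))).comp_aestronglyMeasurable
      hgint.aestronglyMeasurable
  have hint : Integrable (fun ω => F (w - α • T (g ω))) μ := by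
    have hdifference : Integrable
        (fun ω => F (w - α • T (g ω)) - (F w - α * ⟪T (gradient F w), g ω⟫)) μ :=
      hquad.mono' (hmeas.sub hlin.aestronglyMeasurable) (ae_of_all _ hexp)
    exact (hdifference.add hlin).congr (ae_of_all _ fun ω => sub_add_cancel _ _)
  calc ∫ ω, F (w - α • T (g ω)) ∂μ
      ≤ ∫ ω, ((F w - α * ⟪T (gradient F w), g ω⟫) +
          Λ / 2 * (α ^ 2 * μ₂ ^ 2) * ‖g ω‖ ^ 2) ∂μ :=
        integral_mono hint (hlin.add hquad) fun ω =>
          sub_le_iff_le_add'.1 ((le_abs_self _).trans (hexp ω))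
    _ = F w - α * ⟪T (gradient F w), gradient F w⟫ +
          Λ / 2 * (α ^ 2 * μ₂ ^ 2) * ∫ ω, ‖g ω‖ ^ 2 ∂μ := by
        rw [integral_add hlin hquad, integral_sub (integrable_const _)
          ((hgint.const_inner _).const_mul _), integral_const_mul, integral_const_mul,
          integral_inner hgint, hgmean]
        simp
    _ ≤ F w - α * (μ₁ * ‖gradient F w‖ ^ 2) + Λ / 2 * (α ^ 2 * μ₂ ^ 2) * γ ^ 2 := by
        gcongr
        exact hlower _
    _ = _ := by ring
end

section
/- Let F : ℝ^d → ℝ be twice continuously differentiable with λ·I ⪯ ∇²F(w) ⪯ Λ·I for all w, where 0 < λ ≤ Λ, and let w* be the (unique) minimizer of F with F* = F(w*). Fix w ∈ ℝ^d, a symmetric matrix H with μ₁·I ⪯ H ⪯ μ₂·I for constants 0 < μ₁ ≤ μ₂, a step α > 0, and γ ≥ 0. Let g be an ℝ^d-valued random vector with E[g] = ∇F(w) and E[‖g‖²] ≤ γ². Then E[F(w − α H g)] − F* ≤ (1 − 2 α μ₁ λ)·(F(w) − F*) + (α² μ₂² γ² Λ)/2. -/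
open Matrix MeasureTheory
open scoped RealInnerProductSpace

/-- A second-order Taylor bound on `[0, 1]` from an upper bound on the second derivative. -/
theorem le_add_add_half_of_hasDerivAt_le {φ ψ χ : ℝ → ℝ} {C : ℝ}
    (hφ : ∀ t, HasDerivAt φ (ψ t) t) (hψ : ∀ t, HasDerivAt ψ (χ t) t) (hχ : ∀ t, χ t ≤ C) :
    φ 1 ≤ φ 0 + ψ 0 + C / 2 := by
  have slope : ∀ t, 0 ≤ t → ψ t - ψ 0 ≤ C * t := by
    intro t ht
    have := image_sub_le_mul_sub_of_deriv_le (fun s => (hψ s).differentiableAt)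
      (fun s => (hψ s).deriv.trans_le (hχ s)) ht
    simpa using this
  have hd : ∀ t, HasDerivAt (fun s => φ s - ψ 0 * s - C / 2 * s ^ 2) (ψ t - ψ 0 - C * t) t := by
    intro t
    refine (((hφ t).sub ((hasDerivAt_id t).const_mul (ψ 0))).sub
      ((hasDerivAt_pow 2 t).const_mul (C / 2))).congr_deriv ?_
    push_cast
    ring
  have anti : AntitoneOn (fun s => φ s - ψ 0 * s - C / 2 * s ^ 2) (Set.Icc 0 1) := by
    apply antitoneOn_of_deriv_nonpos (convex_Icc 0 1)
    · exact fun t _ => (hd t).continuousAt.continuousWithinAt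
    · exact fun t _ => (hd t).differentiableAt.differentiableWithinAt
    · intro t ht
      rw [interior_Icc] at ht
      rw [(hd t).deriv]
      linarith [slope t ht.1.le]
  have := anti (Set.left_mem_Icc.2 zero_le_one) (Set.right_mem_Icc.2 zero_le_one) zero_le_one
  norm_num at this
  linarith

section Gradient

variable {E : Type*} [NormedAddCommGroup E] [InnerProductSpace ℝ E] [CompleteSpace E]

theorem ContDiff.differentiable_gradient {F : E → ℝ} (hF : ContDiff ℝ 2 F) :
    Differentiable ℝ (gradient F) := by
  have h : ContDiff ℝ 1 (fderiv ℝ F) := hF.fderiv_right (by norm_num)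
  exact ((InnerProductSpace.toDual ℝ E).symm.differentiable).comp
    (h.differentiable (by norm_num))

theorem ContDiff.hasDerivAt_comp_line {F : E → ℝ} (hF : ContDiff ℝ 2 F) (u v : E) (t : ℝ) :
    HasDerivAt (fun s : ℝ => F (u + s • v)) ⟪v, gradient F (u + t • v)⟫ t := by
  have hline : HasDerivAt (fun s : ℝ => u + s • v) v t := by
    simpa using ((hasDerivAt_id t).smul_const v).const_add u
  have := ((hF.differentiable (by norm_num)) (u + t • v)).hasGradientAt.hasFDerivAt.comp_hasDerivAt
    t hline
  rw [InnerProductSpace.toDual_apply_apply, real_inner_comm] at this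
  exact this

theorem ContDiff.hasDerivAt_inner_gradient_line {F : E → ℝ} (hF : ContDiff ℝ 2 F) (u v : E)
    (t : ℝ) :
    HasDerivAt (fun s : ℝ => ⟪v, gradient F (u + s • v)⟫)
      ⟪v, fderiv ℝ (gradient F) (u + t • v) v⟫ t := by
  have hline : HasDerivAt (fun s : ℝ => u + s • v) v t := by
    simpa using ((hasDerivAt_id t).smul_const v).const_add u
  have := (hF.differentiable_gradient (u + t • v)).hasFDerivAt.comp_hasDerivAt t hline
  simpa using (hasDerivAt_const t v).inner ℝ this

/-- The descent inequality for a function whose Hessian is bounded above. -/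
theorem ContDiff.le_add_inner_gradient_add_sq {F : E → ℝ} (hF : ContDiff ℝ 2 F) {L : ℝ}
    (hL : ∀ u v : E, ⟪v, fderiv ℝ (gradient F) u v⟫ ≤ L * ‖v‖ ^ 2) (u v : E) :
    F (u + v) ≤ F u + ⟪v, gradient F u⟫ + L / 2 * ‖v‖ ^ 2 := by
  have := le_add_add_half_of_hasDerivAt_le (hF.hasDerivAt_comp_line u v)
    (hF.hasDerivAt_inner_gradient_line u v) (fun t => hL (u + t • v) v)
  simp only [one_smul, zero_smul, add_zero] at this
  linarith

/-- The quadratic lower bound for a function whose Hessian is bounded below. -/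
theorem ContDiff.add_inner_gradient_add_sq_le {F : E → ℝ} (hF : ContDiff ℝ 2 F) {l : ℝ}
    (hl : ∀ u v : E, l * ‖v‖ ^ 2 ≤ ⟪v, fderiv ℝ (gradient F) u v⟫) (u v : E) :
    F u + ⟪v, gradient F u⟫ + l / 2 * ‖v‖ ^ 2 ≤ F (u + v) := by
  have := le_add_add_half_of_hasDerivAt_le (fun t => (hF.hasDerivAt_comp_line u v t).neg)
    (fun t => (hF.hasDerivAt_inner_gradient_line u v t).neg)
    (fun t => neg_le_neg (hl (u + t • v) v))
  simp only [one_smul, zero_smul, add_zero, Pi.neg_apply] at this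
  linarith

/-- Strong convexity implies the Polyak–Łojasiewicz inequality. -/
theorem ContDiff.two_mul_sub_le_norm_gradient_sq {F : E → ℝ} (hF : ContDiff ℝ 2 F) {l : ℝ}
    (hl0 : 0 < l) (hl : ∀ u v : E, l * ‖v‖ ^ 2 ≤ ⟪v, fderiv ℝ (gradient F) u v⟫) (u x : E) :
    2 * l * (F u - F x) ≤ ‖gradient F u‖ ^ 2 := by
  have h := hF.add_inner_gradient_add_sq_le hl u (x - u)
  rw [add_sub_cancel] at h
  have hsq : 0 ≤ ‖l • (x - u) + gradient F u‖ ^ 2 := sq_nonneg _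
  rw [norm_add_sq_real, norm_smul, real_inner_smul_left, mul_pow, Real.norm_eq_abs, sq_abs] at hsq
  nlinarith

end Gradient

section Symmetric

variable {E : Type*} [NormedAddCommGroup E] [InnerProductSpace ℝ E]

/-- A symmetric operator whose quadratic form is bounded by `c > 0` on the unit sphere has norm at
most `c`. -/
theorem LinearMap.IsSymmetric.norm_apply_le_of_abs_inner_le {T : E →ₗ[ℝ] E} (hT : T.IsSymmetric)
    {c : ℝ} (hc : 0 < c) (h : ∀ x, |⟪x, T x⟫| ≤ c * ‖x‖ ^ 2) (x : E) :
    ‖T x‖ ≤ c * ‖x‖ := by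
  have hplus := (abs_le.1 (h (c • x + T x))).2
  have hminus := (abs_le.1 (h (c • x - T x))).1
  have hsymm : ⟪x, T (T x)⟫ = ‖T x‖ ^ 2 := by
    rw [← hT x (T x), real_inner_self_eq_norm_sq]
  rw [norm_add_sq_real, norm_smul, mul_pow, Real.norm_eq_abs, sq_abs] at hplus
  rw [norm_sub_sq_real, norm_smul, mul_pow, Real.norm_eq_abs, sq_abs] at hminus
  simp only [map_add, map_sub, map_smul, inner_add_left, inner_add_right, inner_sub_left,
    inner_sub_right, real_inner_smul_left, real_inner_smul_right, hsymm,
    real_inner_self_eq_norm_sq] at hplus hminus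
  have hsq : c * ‖T x‖ ^ 2 ≤ c * (c * ‖x‖) ^ 2 := by nlinarith
  exact (sq_le_sq₀ (norm_nonneg _) (by positivity)).1 (le_of_mul_le_mul_left hsq hc)

end Symmetric

theorem Matrix.PosSemidef.inner_toEuclideanLin_nonneg {d : ℕ} {A : Matrix (Fin d) (Fin d) ℝ}
    (hA : A.PosSemidef) (x : EuclideanSpace ℝ (Fin d)) : 0 ≤ ⟪x, Matrix.toEuclideanLin A x⟫ := by
  simpa using (Matrix.isPositive_toEuclideanLin_iff.2 hA).re_inner_nonneg_right x

/-- per-iteration contraction for strongly convex `F`: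
if `λ·I ⪯ ∇²F ⪯ Λ·I`, `w*` minimizes `F`, `μ₁·I ⪯ H ⪯ μ₂·I` symmetric, and `g` is a
random vector with `E[g] = ∇F(w)` and `E[‖g‖²] ≤ γ²`, then
`E[F(w − αHg)] − F* ≤ (1 − 2αμ₁λ)(F(w) − F*) + α²μ₂²γ²Λ/2`. -/
theorem stmt_11 {d : ℕ} {Ω : Type*} [MeasurableSpace Ω] (μ : Measure Ω)
    [IsProbabilityMeasure μ]
    (F : EuclideanSpace ℝ (Fin d) → ℝ) (lam Lam : ℝ)
    (hlam : 0 < lam) (hlamLam : lam ≤ Lam) (hF : ContDiff ℝ 2 F)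
    (hHess : ∀ u v : EuclideanSpace ℝ (Fin d),
      lam * ‖v‖ ^ 2 ≤ ⟪v, fderiv ℝ (gradient F) u v⟫ ∧
        ⟪v, fderiv ℝ (gradient F) u v⟫ ≤ Lam * ‖v‖ ^ 2)
    (wstar : EuclideanSpace ℝ (Fin d)) (hmin : ∀ x, F wstar ≤ F x)
    (w : EuclideanSpace ℝ (Fin d))
    (H : Matrix (Fin d) (Fin d) ℝ) (hHsymm : H.IsSymm)
    (μ₁ μ₂ : ℝ) (hμ₁ : 0 < μ₁) (hμ₁₂ : μ₁ ≤ μ₂)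
    (hH1 : (H - μ₁ • 1).PosSemidef)
    (hH2 : ((μ₂ • 1 : Matrix (Fin d) (Fin d) ℝ) - H).PosSemidef)
    (α : ℝ) (hα : 0 < α) (γ : ℝ) (hγ : 0 ≤ γ)
    (g : Ω → EuclideanSpace ℝ (Fin d))
    (hgint : Integrable g μ)
    (hgmean : ∫ ω, g ω ∂μ = gradient F w)
    (hg2int : Integrable (fun ω => ‖g ω‖ ^ 2) μ)
    (hg2 : ∫ ω, ‖g ω‖ ^ 2 ∂μ ≤ γ ^ 2) :
    (∫ ω, F (w - α • Matrix.toEuclideanLin H (g ω)) ∂μ) - F wstar ≤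
      (1 - 2 * α * μ₁ * lam) * (F w - F wstar) + α ^ 2 * μ₂ ^ 2 * γ ^ 2 * Lam / 2 := by
  have hq1 : ∀ x, μ₁ * ‖x‖ ^ 2 ≤ ⟪x, Matrix.toEuclideanLin H x⟫ := by
    intro x
    have := hH1.inner_toEuclideanLin_nonneg x
    rw [map_sub, map_smul, LinearMap.sub_apply, LinearMap.smul_apply,
      Matrix.toLpLin_one, LinearMap.id_apply, inner_sub_right, real_inner_smul_right,
      real_inner_self_eq_norm_sq] at this
    linarith
  have hq2 : ∀ x, ⟪x, Matrix.toEuclideanLin H x⟫ ≤ μ₂ * ‖x‖ ^ 2 := by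
    intro x
    have := hH2.inner_toEuclideanLin_nonneg x
    rw [map_sub, map_smul, LinearMap.sub_apply, LinearMap.smul_apply,
      Matrix.toLpLin_one, LinearMap.id_apply, inner_sub_right, real_inner_smul_right,
      real_inner_self_eq_norm_sq] at this
    linarith
  have hT : (Matrix.toEuclideanLin H).IsSymmetric :=
    Matrix.isSymmetric_toEuclideanLin_iff.2 (by simpa [Matrix.IsHermitian] using hHsymm.eq)
  have hnorm : ∀ x, ‖Matrix.toEuclideanLin H x‖ ≤ μ₂ * ‖x‖ :=
    hT.norm_apply_le_of_abs_inner_le (hμ₁.trans_le hμ₁₂) fun x => by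
      rw [abs_of_nonneg ((by positivity : 0 ≤ μ₁ * ‖x‖ ^ 2).trans (hq1 x))]
      exact hq2 x
  have hLam : 0 < Lam := hlam.trans_le hlamLam
  set p := Matrix.toEuclideanLin H (gradient F w) with hp
  have hstep : ∀ x, F (w - α • Matrix.toEuclideanLin H x) ≤
      F w - α * ⟪p, x⟫ + Lam / 2 * α ^ 2 * μ₂ ^ 2 * ‖x‖ ^ 2 := by
    intro x
    have hdescent := hF.le_add_inner_gradient_add_sq (fun u v => (hHess u v).2) w
      (-(α • Matrix.toEuclideanLin H x))
    rw [← sub_eq_add_neg, inner_neg_left, real_inner_smul_left, norm_neg, norm_smul, mul_pow,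
      Real.norm_eq_abs, sq_abs, hT, ← hp, real_inner_comm] at hdescent
    have hsq : ‖Matrix.toEuclideanLin H x‖ ^ 2 ≤ μ₂ ^ 2 * ‖x‖ ^ 2 := by
      rw [← mul_pow]
      exact pow_le_pow_left₀ (norm_nonneg _) (hnorm x) 2
    have := mul_le_mul_of_nonneg_left hsq (by positivity : 0 ≤ Lam / 2 * α ^ 2)
    linarith
  have hinner : Integrable (fun ω => α * ⟪p, g ω⟫) μ := (hgint.const_inner p).const_mul α
  have hlinear : Integrable (fun ω => F w - α * ⟪p, g ω⟫) μ := (integrable_const _).sub hinner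
  have hquad : Integrable (fun ω => Lam / 2 * α ^ 2 * μ₂ ^ 2 * ‖g ω‖ ^ 2) μ := hg2int.const_mul _
  have hcont : Continuous fun x => F (w - α • Matrix.toEuclideanLin H x) :=
    hF.continuous.comp (continuous_const.sub
      ((LinearMap.continuous_of_finiteDimensional _).const_smul α))
  have hint : Integrable (fun ω => F (w - α • Matrix.toEuclideanLin H (g ω))) μ :=
    integrable_of_le_of_le (hcont.comp_aestronglyMeasurable hgint.aestronglyMeasurable)
      (ae_of_all _ fun ω => hmin _) (ae_of_all _ fun ω => hstep (g ω))
      (integrable_const _) (hlinear.add hquad)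
  have hmean : ∫ ω, F (w - α • Matrix.toEuclideanLin H (g ω)) ∂μ ≤
      F w - α * ⟪p, gradient F w⟫ + Lam / 2 * α ^ 2 * μ₂ ^ 2 * ∫ ω, ‖g ω‖ ^ 2 ∂μ := by
    refine (integral_mono hint (hlinear.add hquad) fun ω => hstep (g ω)).trans_eq ?_
    simp only [Pi.add_apply]
    rw [integral_add hlinear hquad, integral_sub (integrable_const _) hinner, integral_const_mul,
      integral_const_mul, integral_inner hgint, hgmean]
    simp
  have hdecrease : α * (μ₁ * (2 * lam * (F w - F wstar))) ≤ α * ⟪p, gradient F w⟫ := by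
    rw [real_inner_comm]
    gcongr
    refine le_trans ?_ (hq1 _)
    gcongr
    exact hF.two_mul_sub_le_norm_gradient_sq hlam (fun u v => (hHess u v).1) w wstar
  have hvariance := mul_le_mul_of_nonneg_left hg2 (by positivity : 0 ≤ Lam / 2 * α ^ 2 * μ₂ ^ 2)
  linarith
end

section
/- (Theorem 3.4, nonconvex case.) Let F : ℝ^d → ℝ be differentiable with ∇F Λ-Lipschitz continuous (Λ > 0) and bounded below by F̂ ∈ ℝ. Let (Ω, 𝓕, ℙ) be a probability space with a filtration (𝓕_k)_{k≥0}, let 0 < μ₁ ≤ μ₂, γ ≥ 0, η > 0, and let the step length satisfy 0 < α ≤ μ₁/(μ₂² η Λ). Let w₀ ∈ ℝ^d be deterministic and define recursively w_{k+1} = w_k − α H_k g_k, where: H_k is an 𝓕_k-measurable random symmetric d×d matrix with μ₁·I ⪯ H_k ⪯ μ₂·I almost surely; g_k is an 𝓕_{k+1}-measurable ℝ^d-valued random vector with E[g_k | 𝓕_k] = ∇F(w_k) and E[‖g_k‖² | 𝓕_k] ≤ γ² + η‖∇F(w_k)‖² almost surely. Then for every integer L ≥ 1, E[(1/L)·Σ_{k=0}^{L−1}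 ‖∇F(w_k)‖²] ≤ (α μ₂² γ² Λ)/μ₁ + 2·(F(w₀) − F̂)/(α μ₁ L). -/
open Matrix MeasureTheory
open scoped RealInnerProductSpace

/-- The descent lemma: a function with `Λ`-Lipschitz gradient is bounded above by its quadratic
model. -/
theorem descent_of_lipschitz_gradient {E : Type*} [NormedAddCommGroup E] [InnerProductSpace ℝ E]
    [CompleteSpace E] {F : E → ℝ} {Λ : ℝ} (hdiff : Differentiable ℝ F)
    (hlip : ∀ u v, ‖gradient F u - gradient F v‖ ≤ Λ * ‖u - v‖) (x v : E) :
    F (x + v) ≤ F x + ⟪gradient F x, v⟫ + Λ / 2 * ‖v‖ ^ 2 := by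
  let φ : ℝ → ℝ := fun t => F (x + t • v) - t * ⟪gradient F x, v⟫ - Λ / 2 * ‖v‖ ^ 2 * t ^ 2
  have hφ (t : ℝ) : HasDerivAt φ
      (⟪gradient F (x + t • v), v⟫ - ⟪gradient F x, v⟫ - Λ / 2 * ‖v‖ ^ 2 * (2 * t)) t := by
    have hline : HasDerivAt (fun t : ℝ => x + t • v) v t := by
      simpa using ((hasDerivAt_id t).smul_const v).const_add x
    have hF : HasDerivAt (fun t : ℝ => F (x + t • v)) ⟪gradient F (x + t • v), v⟫ t := by
      exact (hdiff (x + t • v)).hasGradientAt.hasFDerivAt.comp_hasDerivAt t hline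
    refine (hF.sub ?_).sub ?_
    · simpa using (hasDerivAt_id t).mul_const ⟪gradient F x, v⟫
    · simpa using (hasDerivAt_pow 2 t).const_mul (Λ / 2 * ‖v‖ ^ 2)
  have hanti : AntitoneOn φ (Set.Icc 0 1) := by
    refine antitoneOn_of_deriv_nonpos (convex_Icc 0 1)
      (fun t _ => (hφ t).continuousAt.continuousWithinAt)
      (fun t _ => (hφ t).differentiableAt.differentiableWithinAt) fun t ht => ?_
    rw [interior_Icc] at ht
    rw [(hφ t).deriv, ← inner_sub_left]
    have hcs := real_inner_le_norm (gradient F (x + t • v) - gradient F x) v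
    have hgrad := hlip (x + t • v) x
    rw [add_sub_cancel_left, norm_smul, Real.norm_of_nonneg ht.1.le] at hgrad
    nlinarith [mul_le_mul_of_nonneg_right hgrad (norm_nonneg v)]
  have h01 := hanti (Set.left_mem_Icc.2 zero_le_one) (Set.right_mem_Icc.2 zero_le_one) zero_le_one
  simp only [φ, one_smul, zero_smul, add_zero] at h01
  linarith

/-- A symmetric operator `T` with `0 ⪯ T ⪯ c` has norm at most `c`. -/
theorem LinearMap.IsSymmetric.norm_apply_le_of_inner_le {E : Type*} [NormedAddCommGroup E]
    [InnerProductSpace ℝ E] {T : E →ₗ[ℝ] E} (hT : T.IsSymmetric) {c : ℝ} (hc : 0 < c)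
    (hpos : ∀ x, 0 ≤ ⟪T x, x⟫) (hle : ∀ x, ⟪T x, x⟫ ≤ c * ‖x‖ ^ 2) (x : E) :
    ‖T x‖ ≤ c * ‖x‖ := by
  have hcomb := hpos (c • x - T x)
  have hexpand : ⟪T (c • x - T x), c • x - T x⟫ =
      c ^ 2 * ⟪T x, x⟫ - 2 * c * ‖T x‖ ^ 2 + ⟪T (T x), T x⟫ := by
    rw [map_sub, map_smul, inner_sub_left, inner_sub_right, inner_sub_right, real_inner_smul_left,
      real_inner_smul_left, real_inner_smul_right, real_inner_smul_right, hT (T x) x,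
      real_inner_self_eq_norm_sq]
    ring
  rw [hexpand] at hcomb
  have hsq : c * ‖T x‖ ^ 2 ≤ c * (c ^ 2 * ‖x‖ ^ 2) := by
    nlinarith [hle (T x), mul_le_mul_of_nonneg_left (hle x) (sq_nonneg c)]
  refine (pow_le_pow_iff_left₀ (norm_nonneg _) (by positivity) two_ne_zero).1 ?_
  rw [mul_pow]
  exact le_of_mul_le_mul_left hsq hc

namespace Matrix

variable {n : Type*} [Fintype n] [DecidableEq n] {A : Matrix n n ℝ} {c : ℝ}

theorem PosSemidef.mul_sq_norm_le_inner_toEuclideanLin (hA : (A - c • 1).PosSemidef)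
    (x : EuclideanSpace ℝ n) : c * ‖x‖ ^ 2 ≤ ⟪A.toEuclideanLin x, x⟫ := by
  have h := (isPositive_toEuclideanLin_iff.2 hA).2 x
  simp only [map_sub, map_smul, LinearMap.sub_apply, LinearMap.smul_apply, inner_sub_left,
    real_inner_smul_left, RCLike.re_to_real, toLpLin_one, LinearMap.id_apply,
    real_inner_self_eq_norm_sq] at h
  linarith

theorem PosSemidef.inner_toEuclideanLin_le_mul_sq_norm
    (hA : ((c • 1 : Matrix n n ℝ) - A).PosSemidef) (x : EuclideanSpace ℝ n) :
    ⟪A.toEuclideanLin x, x⟫ ≤ c * ‖x‖ ^ 2 := by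
  have h := (isPositive_toEuclideanLin_iff.2 hA).2 x
  simp only [map_sub, map_smul, LinearMap.sub_apply, LinearMap.smul_apply, inner_sub_left,
    real_inner_smul_left, RCLike.re_to_real, toLpLin_one, LinearMap.id_apply,
    real_inner_self_eq_norm_sq] at h
  linarith

theorem measurable_toEuclideanLin_apply {Ω : Type*} {m : MeasurableSpace Ω}
    {H : Ω → Matrix n n ℝ} {v : Ω → EuclideanSpace ℝ n}
    (hH : ∀ i j, Measurable fun ω => H ω i j) (hv : Measurable v) :
    Measurable fun ω => (H ω).toEuclideanLin (v ω) := by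
  have hcoord (j : n) : Measurable fun ω => v ω j :=
    (EuclideanSpace.proj (𝕜 := ℝ) j).continuous.measurable.comp hv
  simp only [toLpLin_apply]
  refine (PiLp.continuous_toLp 2 fun _ : n => ℝ).measurable.comp (measurable_pi_lambda _ fun i => ?_)
  simp only [mulVec, dotProduct]
  exact Finset.measurable_sum _ fun j _ => (hH i j).mul (hcoord j)

end Matrix

/-- Pull-out property for the inner product, integrated. -/
theorem MeasureTheory.integral_inner_condExp {Ω E : Type*} [NormedAddCommGroup E]
    [InnerProductSpace ℝ E] [CompleteSpace E] {m m0 : MeasurableSpace Ω} {μ : Measure Ω}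
    (hm : m ≤ m0) [SigmaFinite (μ.trim hm)] {X Y : Ω → E} (hX : StronglyMeasurable[m] X)
    (hXY : Integrable (fun ω => ⟪X ω, Y ω⟫) μ) (hY : Integrable Y μ) :
    ∫ ω, ⟪X ω, Y ω⟫ ∂μ = ∫ ω, ⟪X ω, (μ[Y | m]) ω⟫ ∂μ := by
  rw [← integral_condExp hm]
  exact integral_congr_ae (condExp_bilin_of_stronglyMeasurable_left (innerSL ℝ) hX hXY hY)

/-- Expected decrease of `F` along one step `x - α H g`, where `H` is known at time `m` and `g` is
an unbiased stochastic gradient. -/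
theorem integral_quasiNewton_step_le {n Ω : Type*} [Fintype n] [DecidableEq n]
    {m m0 : MeasurableSpace Ω} {μ : Measure Ω} [IsProbabilityMeasure μ] (hm : m ≤ m0)
    {F : EuclideanSpace ℝ n → ℝ} {Λ : ℝ} (hΛ : 0 < Λ) (hdiff : Differentiable ℝ F)
    (hlip : ∀ u v, ‖gradient F u - gradient F v‖ ≤ Λ * ‖u - v‖)
    {μ₁ μ₂ γ η α : ℝ} (hμ₁ : 0 < μ₁) (hμ₂ : 0 < μ₂) (hα : 0 < α)
    (hstep : α * (μ₂ ^ 2 * η * Λ) ≤ μ₁)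
    {H : Ω → Matrix n n ℝ} {g x x' : Ω → EuclideanSpace ℝ n}
    (hrec : ∀ ω, x' ω = x ω - α • (H ω).toEuclideanLin (g ω))
    (hx : Measurable[m] x) (hH : ∀ i j, Measurable[m] fun ω => H ω i j)
    (hsymm : ∀ᵐ ω ∂μ, (H ω).IsSymm)
    (hbound : ∀ᵐ ω ∂μ, (H ω - μ₁ • 1).PosSemidef ∧
      ((μ₂ • 1 : Matrix n n ℝ) - H ω).PosSemidef)
    (hg : Integrable g μ) (hg2 : Integrable (fun ω => ‖g ω‖ ^ 2) μ)
    (hcond : μ[g | m] =ᵐ[μ] fun ω => gradient F (x ω))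
    (hcond2 : ∀ᵐ ω ∂μ, (μ[fun ω' => ‖g ω'‖ ^ 2 | m]) ω ≤ γ ^ 2 + η * ‖gradient F (x ω)‖ ^ 2)
    (hF : Integrable (fun ω => F (x ω)) μ) (hF' : Integrable (fun ω => F (x' ω)) μ)
    (hgrad : Integrable (fun ω => ‖gradient F (x ω)‖ ^ 2) μ) :
    ∫ ω, F (x' ω) ∂μ ≤ ∫ ω, F (x ω) ∂μ - α * μ₁ / 2 * ∫ ω, ‖gradient F (x ω)‖ ^ 2 ∂μ +
      Λ / 2 * α ^ 2 * μ₂ ^ 2 * γ ^ 2 := by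
  set G : Ω → EuclideanSpace ℝ n := fun ω => gradient F (x ω)
  set X : Ω → EuclideanSpace ℝ n := fun ω => (H ω).toEuclideanLin (G ω)
  have hop : ∀ᵐ ω ∂μ, (H ω).toEuclideanLin.IsSymmetric ∧
      ∀ v, ‖(H ω).toEuclideanLin v‖ ≤ μ₂ * ‖v‖ := by
    filter_upwards [hsymm, hbound] with ω hs hb
    have hS : (H ω).toEuclideanLin.IsSymmetric :=
      isSymmetric_toEuclideanLin_iff.2 (by simpa [IsHermitian] using hs.eq)
    exact ⟨hS, hS.norm_apply_le_of_inner_le hμ₂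
      (fun v => le_trans (by positivity) (hb.1.mul_sq_norm_le_inner_toEuclideanLin v))
      hb.2.inner_toEuclideanLin_le_mul_sq_norm⟩
  have hgradLip : LipschitzWith ⟨Λ, hΛ.le⟩ (gradient F) :=
    LipschitzWith.of_dist_le_mul fun u v => by simpa only [dist_eq_norm] using! hlip u v
  have hXmeas : Measurable[m] X :=
    measurable_toEuclideanLin_apply hH (hgradLip.continuous.measurable.comp hx)
  have hXg : Integrable (fun ω => ⟪X ω, g ω⟫) μ := by
    refine Integrable.mono' ((hgrad.add hg2).const_mul μ₂)
      ((hXmeas.mono hm le_rfl).aestronglyMeasurable.inner hg.aestronglyMeasurable) ?_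
    filter_upwards [hop] with ω hω
    calc ‖⟪X ω, g ω⟫‖ ≤ ‖X ω‖ * ‖g ω‖ := norm_inner_le_norm _ _
      _ ≤ μ₂ * ‖G ω‖ * ‖g ω‖ := by gcongr; exact hω.2 _
      _ = μ₂ * (‖G ω‖ * ‖g ω‖) := by ring
      _ ≤ μ₂ * (‖G ω‖ ^ 2 + ‖g ω‖ ^ 2) := by
        gcongr
        nlinarith [sq_nonneg (‖G ω‖ - ‖g ω‖), sq_nonneg ‖G ω‖, sq_nonneg ‖g ω‖]
  have hXG : Integrable (fun ω => ⟪X ω, G ω⟫) μ := by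
    refine Integrable.mono' (hgrad.const_mul μ₂) ((hXmeas.mono hm le_rfl).aestronglyMeasurable.inner
      ((hgradLip.continuous.measurable.comp hx).mono hm le_rfl).aestronglyMeasurable) ?_
    filter_upwards [hop] with ω hω
    calc ‖⟪X ω, G ω⟫‖ ≤ ‖X ω‖ * ‖G ω‖ := norm_inner_le_norm _ _
      _ ≤ μ₂ * ‖G ω‖ * ‖G ω‖ := by gcongr; exact hω.2 _
      _ = μ₂ * ‖G ω‖ ^ 2 := by ring
  have hfirst : μ₁ * ∫ ω, ‖G ω‖ ^ 2 ∂μ ≤ ∫ ω, ⟪X ω, g ω⟫ ∂μ := by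
    have hcongr : ∫ ω, ⟪X ω, (μ[g | m]) ω⟫ ∂μ = ∫ ω, ⟪X ω, G ω⟫ ∂μ :=
      integral_congr_ae (hcond.mono fun ω hω => by simp only [hω, G])
    rw [integral_inner_condExp hm hXmeas.stronglyMeasurable hXg hg, hcongr, ← integral_const_mul]
    exact integral_mono_ae (hgrad.const_mul μ₁) hXG
      (hbound.mono fun ω hω => hω.1.mul_sq_norm_le_inner_toEuclideanLin (G ω))
  have hsecond : ∫ ω, ‖g ω‖ ^ 2 ∂μ ≤ γ ^ 2 + η * ∫ ω, ‖G ω‖ ^ 2 ∂μ := by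
    rw [← integral_condExp hm]
    refine (integral_mono_ae integrable_condExp
      ((integrable_const (γ ^ 2)).add (hgrad.const_mul η)) hcond2).trans_eq ?_
    rw [integral_add' (integrable_const _) (hgrad.const_mul η), integral_const_mul]
    simp [G]
  have hlin : Integrable (fun ω => F (x ω) - α * ⟪X ω, g ω⟫) μ := hF.sub (hXg.const_mul α)
  have hdescent : ∫ ω, F (x' ω) ∂μ ≤ ∫ ω, F (x ω) ∂μ - α * ∫ ω, ⟪X ω, g ω⟫ ∂μ +
      Λ / 2 * α ^ 2 * μ₂ ^ 2 * ∫ ω, ‖g ω‖ ^ 2 ∂μ := by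
    rw [← integral_const_mul, ← integral_const_mul, ← integral_sub hF (hXg.const_mul α),
      ← integral_add hlin (hg2.const_mul _)]
    refine integral_mono_ae hF' (hlin.add (hg2.const_mul _)) ?_
    filter_upwards [hop] with ω hω
    have hd := descent_of_lipschitz_gradient hdiff hlip (x ω)
      (-(α • (H ω).toEuclideanLin (g ω)))
    rw [← sub_eq_add_neg, ← hrec ω, inner_neg_right, real_inner_smul_right, ← hω.1 (G ω) (g ω),
      norm_neg, norm_smul, Real.norm_of_nonneg hα.le] at hd
    have hsq : (α * ‖(H ω).toEuclideanLin (g ω)‖) ^ 2 ≤ (α * (μ₂ * ‖g ω‖)) ^ 2 := by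
      gcongr
      exact hω.2 _
    change F (x' ω) ≤ F (x ω) - α * ⟪(H ω).toEuclideanLin (G ω), g ω⟫ + _
    nlinarith [mul_le_mul_of_nonneg_left hsq (half_pos hΛ).le]
  have hGnonneg : 0 ≤ ∫ ω, ‖G ω‖ ^ 2 ∂μ := integral_nonneg fun ω => sq_nonneg _
  have hfirst' := mul_le_mul_of_nonneg_left hfirst hα.le
  have hsecond' := mul_le_mul_of_nonneg_left hsecond
    (show 0 ≤ Λ / 2 * α ^ 2 * μ₂ ^ 2 by positivity)
  have hstep' := mul_le_mul_of_nonneg_left hstep (mul_nonneg hα.le hGnonneg)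
  linarith

/-- Theorem 3.4, nonconvex case: for the multi-batch L-BFGS iteration
`w_{k+1} = w_k − α H_k g_k` with `F` bounded below by `F̂`, `∇F` `Λ`-Lipschitz,
`μ₁·I ⪯ H_k ⪯ μ₂·I` a.s., `E[g_k | 𝓕_k] = ∇F(w_k)`,
`E[‖g_k‖² | 𝓕_k] ≤ γ² + η‖∇F(w_k)‖²` a.s., and `0 < α ≤ μ₁/(μ₂²ηΛ)`, one has for every
`L ≥ 1`: `E[(1/L)Σ_{k<L} ‖∇F(w_k)‖²] ≤ αμ₂²γ²Λ/μ₁ + 2(F(w₀) − F̂)/(αμ₁L)`. -/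
theorem stmt_16 {d : ℕ} {Ω : Type*} {m0 : MeasurableSpace Ω} (μ : Measure Ω)
    [IsProbabilityMeasure μ] (𝓕 : Filtration ℕ m0)
    (F : EuclideanSpace ℝ (Fin d) → ℝ) (Λ : ℝ) (hΛ : 0 < Λ)
    (hdiff : Differentiable ℝ F)
    (hlip : ∀ u v : EuclideanSpace ℝ (Fin d),
      ‖gradient F u - gradient F v‖ ≤ Λ * ‖u - v‖)
    (Fhat : ℝ) (hbelow : ∀ x, Fhat ≤ F x)
    (μ₁ μ₂ γ η α : ℝ) (hμ₁ : 0 < μ₁) (hμ₁₂ : μ₁ ≤ μ₂) (hγ : 0 ≤ γ) (hη : 0 < η)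
    (hα : 0 < α) (hα2 : α ≤ μ₁ / (μ₂ ^ 2 * η * Λ))
    (w0 : EuclideanSpace ℝ (Fin d))
    (H : ℕ → Ω → Matrix (Fin d) (Fin d) ℝ)
    (g : ℕ → Ω → EuclideanSpace ℝ (Fin d))
    (w : ℕ → Ω → EuclideanSpace ℝ (Fin d))
    (hw0 : ∀ ω, w 0 ω = w0)
    (hwrec : ∀ k ω, w (k + 1) ω = w k ω - α • Matrix.toEuclideanLin (H k ω) (g k ω))
    (hHmeas : ∀ k i j, Measurable[𝓕 k] fun ω => H k ω i j)
    (hHsymm : ∀ k, ∀ᵐ ω ∂μ, (H k ω).IsSymm)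
    (hHbound : ∀ k, ∀ᵐ ω ∂μ, (H k ω - μ₁ • 1).PosSemidef ∧
      ((μ₂ • 1 : Matrix (Fin d) (Fin d) ℝ) - H k ω).PosSemidef)
    (hgmeas : ∀ k, Measurable[𝓕 (k + 1)] (g k))
    (hgint : ∀ k, Integrable (g k) μ)
    (hg2int : ∀ k, Integrable (fun ω => ‖g k ω‖ ^ 2) μ)
    (hgcond : ∀ k, μ[g k | 𝓕 k] =ᵐ[μ] fun ω => gradient F (w k ω))
    (hg2cond : ∀ k, ∀ᵐ ω ∂μ,
      (μ[fun ω' => ‖g k ω'‖ ^ 2 | 𝓕 k]) ω ≤ γ ^ 2 + η * ‖gradient F (w k ω)‖ ^ 2)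
    (hFint : ∀ k, Integrable (fun ω => F (w k ω)) μ)
    (hgradint : ∀ k, Integrable (fun ω => ‖gradient F (w k ω)‖ ^ 2) μ) :
    ∀ L : ℕ, 1 ≤ L →
      ∫ ω, (1 / (L : ℝ)) * ∑ k ∈ Finset.range L, ‖gradient F (w k ω)‖ ^ 2 ∂μ ≤
        α * μ₂ ^ 2 * γ ^ 2 * Λ / μ₁ + 2 * (F w0 - Fhat) / (α * μ₁ * L) := by
  have hμ₂ : 0 < μ₂ := hμ₁.trans_le hμ₁₂
  have hstep : α * (μ₂ ^ 2 * η * Λ) ≤ μ₁ := (le_div_iff₀ (by positivity)).1 hα2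
  have hwmeas (k : ℕ) : Measurable[𝓕 k] (w k) := by
    induction k with
    | zero => rw [funext hw0]; exact measurable_const
    | succ k ih =>
      rw [funext (hwrec k)]
      have hle := 𝓕.mono k.le_succ
      exact (ih.mono hle le_rfl).sub ((measurable_toEuclideanLin_apply
        (fun i j => (hHmeas k i j).mono hle le_rfl) (hgmeas k)).const_smul α)
  have hone (k : ℕ) := integral_quasiNewton_step_le (𝓕.le k) hΛ hdiff hlip hμ₁ hμ₂ hα hstep
    (hwrec k) (hwmeas k) (hHmeas k) (hHsymm k) (hHbound k) (hgint k) (hg2int k) (hgcond k)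
    (hg2cond k) (hFint k) (hFint (k + 1)) (hgradint k)
  have htele (L : ℕ) : α * μ₁ / 2 * ∑ k ∈ Finset.range L, ∫ ω, ‖gradient F (w k ω)‖ ^ 2 ∂μ ≤
      F w0 - ∫ ω, F (w L ω) ∂μ + L * (Λ / 2 * α ^ 2 * μ₂ ^ 2 * γ ^ 2) := by
    induction L with
    | zero => simp [hw0]
    | succ L ih =>
      rw [Finset.sum_range_succ]
      push_cast
      linarith [hone L]
  intro L hL
  have hL0 : (0 : ℝ) < L := by exact_mod_cast hL
  have hlow : Fhat ≤ ∫ ω, F (w L ω) ∂μ := by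
    simpa using integral_mono (integrable_const Fhat) (hFint L) fun ω => hbelow (w L ω)
  rw [integral_const_mul, integral_finsetSum _ fun k _ => hgradint k, one_div,
    inv_mul_le_iff₀ hL0]
  refine le_of_mul_le_mul_left (((htele L).trans ?_)) (show 0 < α * μ₁ / 2 by positivity)
  have hrhs : α * μ₁ / 2 * (L * (α * μ₂ ^ 2 * γ ^ 2 * Λ / μ₁ +
      2 * (F w0 - Fhat) / (α * μ₁ * L))) =
      F w0 - Fhat + L * (Λ / 2 * α ^ 2 * μ₂ ^ 2 * γ ^ 2) := by
    field_simp
    ring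
  linarith
end
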